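/- Let d be a positive even integer, A a Γ-equivalence class in F_d, and x an irrational real number. Then the map (P, γ) ↦ P|γ is a bijection from the set {(P, γ) ∈ A^Red × Γ(x)′ : P(γ(∞)) < 0} onto A⟨x⟩. -/

import Mathlib

open Polynomial Matrix

noncomputable section

abbrev Mat2 := Matrix (Fin 2) (Fin 2) ℤ

/-- The matrix `Tⁿ = [[1,n],[0,1]]`. -/
def Tpow (n : ℤ) : Mat2 := !![1, n; 0, 1]

/-- The matrix `ε = [[0,1],[1,0]]`. -/
def Meps : Mat2 := !![0, 1; 1, 0]

/-- The matrix `S = [[0,-1],[1,0]]`. -/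
def MS : Mat2 := !![0, -1; 1, 0]

/-- The matrix `T = [[1,1],[0,1]]`. -/
def MT : Mat2 := !![1, 1; 0, 1]

/-- The matrix `σ = [[-1,0],[0,1]]`. -/
def Msig : Mat2 := !![-1, 0; 0, 1]

/-- The matrix `U = TS = [[1,-1],[1,0]]`. -/
def MU : Mat2 := MT * MS

/-- Möbius action of an integer matrix on a real number. -/
def moeb (M : Mat2) (x : ℝ) : ℝ :=
  ((M 0 0 : ℝ) * x + (M 0 1 : ℝ)) / ((M 1 0 : ℝ) * x + (M 1 1 : ℝ))

/-- The sequence `x_i` of the (positive) continued fraction algorithm: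
`x_0 = x`, `x_{i+1} = 1/(x_i - ⌊x_i⌋)`. -/
def cfX (x : ℝ) : ℕ → ℝ
  | 0 => x
  | i + 1 => 1 / (cfX x i - (⌊cfX x i⌋ : ℝ))

/-- The partial quotients `n_i = ⌊x_i⌋` of the continued fraction of `x`. -/
def cfN (x : ℝ) (i : ℕ) : ℤ := ⌊cfX x i⌋

/-- The matrices `γ_0 = Id`, `γ_{i+1} = ε T^{-n_i} γ_i`. -/
def gam (x : ℝ) : ℕ → Mat2
  | 0 => 1
  | i + 1 => (Meps * Tpow (-(cfN x i))) * gam x i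

/-- `Γ(x) = {γ_1, γ_2, γ_3, …}`. -/
def GammaSet (x : ℝ) : Set Mat2 := {M | ∃ i, 1 ≤ i ∧ M = gam x i}

/-- The matrices `γ'_0 = Id`, `γ'_{i+1} = Tγ'_i` if `γ'_i(x) ≤ 0`,
`T^{-1}εγ'_i` if `0 < γ'_i(x) ≤ 1`, and `T^{-1}γ'_i` if `γ'_i(x) > 1`. -/
def gam' (x : ℝ) : ℕ → Mat2
  | 0 => 1
  | i + 1 =>
    if moeb (gam' x i) x ≤ 0 then MT * gam' x i
    else if moeb (gam' x i) x ≤ 1 then (Tpow (-1) * Meps) * gam' x i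
    else Tpow (-1) * gam' x i

/-- `Γ(x)' = {γ'_1, γ'_2, γ'_3, …}`. -/
def GammaSet' (x : ℝ) : Set Mat2 := {M | ∃ i, 1 ≤ i ∧ M = gam' x i}

/-- The sequence `x_i` of the negative continued fraction algorithm:
`x_0 = x`, `x_{i+1} = 1/(⌈x_i⌉ - x_i)`. -/
def ncfX (x : ℝ) : ℕ → ℝ
  | 0 => x
  | i + 1 => 1 / ((⌈ncfX x i⌉ : ℝ) - ncfX x i)

/-- The partial quotients `m_i = ⌈x_i⌉` of the negative continued fraction of `x`. -/
def ncfM (x : ℝ) (i : ℕ) : ℤ := ⌈ncfX x i⌉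

/-- The matrices `γ̃_0 = Id`, `γ̃_{i+1} = S T^{-m_i} γ̃_i`. -/
def gamt (x : ℝ) : ℕ → Mat2
  | 0 => 1
  | i + 1 => (MS * Tpow (-(ncfM x i))) * gamt x i

/-- `Γ₁(x) = {γ̃_1, γ̃_2, γ̃_3, …}`. -/
def Gamma1Set (x : ℝ) : Set Mat2 := {M | ∃ i, 1 ≤ i ∧ M = gamt x i}

/-- A binary quadratic polynomial `aX² + bX + c`, encoded as the triple `(a,b,c)`. -/
abbrev QF := ℤ × ℤ × ℤ

/-- The value of `aX² + bX + c` at a real number `x`. -/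
def Qval (q : QF) (x : ℝ) : ℝ := (q.1 : ℝ) * x ^ 2 + (q.2.1 : ℝ) * x + (q.2.2 : ℝ)

/-- The value of `aX² + bX + c` at an integer `m`. -/
def QvalZ (q : QF) (m : ℤ) : ℤ := q.1 * m ^ 2 + q.2.1 * m + q.2.2

/-- The discriminant `b² - 4ac`. -/
def Qdisc (q : QF) : ℤ := q.2.1 ^ 2 - 4 * q.1 * q.2.2

/-- The homogenized value `a r² + b r t + c t²`; for `t ≠ 0` its sign is that of `Q(r/t)`,
and for `t = 0` that of the leading coefficient, i.e. of `Q(∞)`. -/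
def Qhom (q : QF) (r t : ℤ) : ℤ := q.1 * r ^ 2 + q.2.1 * r * t + q.2.2 * t ^ 2

/-- The weight 2 action `(Q|γ)(X) = (tX+u)² Q((rX+s)/(tX+u))` on quadratic polynomials,
for `γ = [[r,s],[t,u]]`. -/
def qslash (M : Mat2) (q : QF) : QF :=
  (Qhom q (M 0 0) (M 1 0),
   2 * q.1 * M 0 0 * M 0 1 + q.2.1 * (M 0 0 * M 1 1 + M 0 1 * M 1 0) + 2 * q.2.2 * M 1 0 * M 1 1,
   Qhom q (M 0 1) (M 1 1))

/-- The set `𝒬` of integral quadratic polynomials with positive non-square discriminant. -/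
def Qset : Set QF := {q | 0 < Qdisc q ∧ ¬ IsSquare (Qdisc q)}

/-- `A` is a `Γ`-equivalence class in `𝒬`, where `Γ = PGL₂(ℤ)`. -/
def IsClassQ (A : Set QF) : Prop :=
  ∃ q₀ ∈ Qset, A = {q ∈ Qset | ∃ M : Mat2, IsUnit M.det ∧ q = qslash M q₀}

/-- `B` is a `Γ₁`-equivalence class in `𝒬`, where `Γ₁ = PSL₂(ℤ)`. -/
def IsClassQ1 (B : Set QF) : Prop :=
  ∃ q₀ ∈ Qset, B = {q ∈ Qset | ∃ M : Mat2, M.det = 1 ∧ q = qslash M q₀}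

/-- `A^Sim = {Q ∈ A : Q(0) < 0 < Q(∞)}`. -/
def QSim (A : Set QF) : Set QF := {q ∈ A | q.2.2 < 0 ∧ 0 < q.1}

/-- `A^Red = {Q ∈ A : Q(∞) > 0, Q(-1) < 0 < Q(0)}`. -/
def QRed (A : Set QF) : Set QF := {q ∈ A | 0 < q.1 ∧ q.1 - q.2.1 + q.2.2 < 0 ∧ 0 < q.2.2}

/-- `A⟨x⟩ = {Q ∈ A : Q(∞) < 0 < Q(x)}`. -/
def QxSet (A : Set QF) (x : ℝ) : Set QF := {q ∈ A | q.1 < 0 ∧ 0 < Qval q x}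

/-- `𝒬_D⟨x⟩`, the set of quadratics of discriminant `D` with `Q(∞) < 0 < Q(x)`. -/
def QDx (D : ℕ) (x : ℝ) : Set QF :=
  {q | Qdisc q = (D : ℤ) ∧ q.1 < 0 ∧ 0 < Qval q x}

/-- The simple forms of discriminant `D`: `a > 0 > c`. -/
def SimpleD (D : ℕ) : Set QF := {q | Qdisc q = (D : ℤ) ∧ 0 < q.1 ∧ q.2.2 < 0}

/-- The reduced forms of discriminant `D`: `a > 0`, `c > 0`, `b > a + c`. -/
def ReducedD (D : ℕ) : Set QF :=
  {q | Qdisc q = (D : ℤ) ∧ 0 < q.1 ∧ 0 < q.2.2 ∧ q.1 + q.2.2 < q.2.1}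

/-- Homogenized evaluation of a polynomial of degree ≤ d: `∑ P_j r^j t^{d-j}`;
for `t ≠ 0` its sign is that of `P(r/t)` (`d` even), and for `t = 0` that of `P(∞)`. -/
def homEval (d : ℕ) (P : Polynomial ℤ) (r t : ℤ) : ℤ :=
  ∑ j ∈ Finset.range (d + 1), P.coeff j * r ^ j * t ^ (d - j)

/-- The weight `d` action `(P|γ)(X) = (tX+u)^d P((rX+s)/(tX+u))` on integral polynomials
of degree at most `d`, for `γ = [[r,s],[t,u]]`. -/
def pslash (d : ℕ) (M : Mat2) (P : Polynomial ℤ) : Polynomial ℤ :=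
  ∑ j ∈ Finset.range (d + 1),
    C (P.coeff j) * (C (M 0 0) * X + C (M 0 1)) ^ j * (C (M 1 0) * X + C (M 1 1)) ^ (d - j)

/-- `P` has exactly two real roots `w ≠ w'`, both irrational. -/
def HasTwoIrratRoots (P : Polynomial ℤ) (w w' : ℝ) : Prop :=
  w ≠ w' ∧ Irrational w ∧ Irrational w' ∧ ∀ y : ℝ, Polynomial.aeval y P = 0 ↔ y = w ∨ y = w'

/-- `F_d`: integral polynomials of degree ≤ d with exactly two real roots, both irrational. -/
def Fd (d : ℕ) : Set (Polynomial ℤ) :=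
  {P | P.natDegree ≤ d ∧ ∃ w w' : ℝ, HasTwoIrratRoots P w w'}

/-- `A` is a `Γ`-equivalence class in `F_d`, where `Γ = PGL₂(ℤ)`. -/
def IsClassF (d : ℕ) (A : Set (Polynomial ℤ)) : Prop :=
  ∃ P₀ ∈ Fd d, A = {P ∈ Fd d | ∃ M : Mat2, IsUnit M.det ∧ P = pslash d M P₀}

/-- `B` is a `Γ₁`-equivalence class in `F_d`, where `Γ₁ = PSL₂(ℤ)`. -/
def IsClassF1 (d : ℕ) (B : Set (Polynomial ℤ)) : Prop :=
  ∃ P₀ ∈ Fd d, B = {P ∈ Fd d | ∃ M : Mat2, M.det = 1 ∧ P = pslash d M P₀}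

/-- `A^Sim = {P ∈ A : P(0) < 0 < P(∞)}`, where `P(∞)` is the coefficient of `X^d`. -/
def PSim (d : ℕ) (A : Set (Polynomial ℤ)) : Set (Polynomial ℤ) :=
  {P ∈ A | P.coeff 0 < 0 ∧ 0 < P.coeff d}

/-- `A^Red = {P ∈ A : P(∞) > 0 and P(-1) < 0 < P(0)}`. -/
def PRed (d : ℕ) (A : Set (Polynomial ℤ)) : Set (Polynomial ℤ) :=
  {P ∈ A | 0 < P.coeff d ∧ Polynomial.aeval (-1 : ℤ) P < 0 ∧ 0 < P.coeff 0}

/-- `A⟨x⟩ = {P ∈ A : P(∞) < 0 < P(x)}`. -/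
def Px (d : ℕ) (A : Set (Polynomial ℤ)) (x : ℝ) : Set (Polynomial ℤ) :=
  {P ∈ A | P.coeff d < 0 ∧ 0 < Polynomial.aeval x P}

/-- The numerators of the convergents, shifted by 2: `pconv x i = p_{i-2}`. -/
def pconv (x : ℝ) : ℕ → ℤ
  | 0 => 0
  | 1 => 1
  | i + 2 => cfN x i * pconv x (i + 1) + pconv x i

/-- The denominators of the convergents, shifted by 2: `qconv x i = q_{i-2}`. -/
def qconv (x : ℝ) : ℕ → ℤ
  | 0 => 1
  | 1 => 0
  | i + 2 => cfN x i * qconv x (i + 1) + qconv x i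

/-- `δ_i = (-1)^i (p_{i-1} - q_{i-1} x)` for `i ≥ 0`. -/
def cfDelta (x : ℝ) (i : ℕ) : ℝ :=
  (-1 : ℝ) ^ i * ((pconv x (i + 1) : ℝ) - (qconv x (i + 1) : ℝ) * x)

/-- The weight `d` action `(P|γ)(X) = (tX+u)^d P((rX+s)/(tX+u))` on complex polynomials
of degree at most `d`, for `γ = [[r,s],[t,u]]` with integer entries. -/
def cslash (d : ℕ) (M : Mat2) (P : Polynomial ℂ) : Polynomial ℂ :=
  ∑ j ∈ Finset.range (d + 1),
    C (P.coeff j) * (C (M 0 0 : ℂ) * X + C (M 0 1 : ℂ)) ^ j *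
      (C (M 1 0 : ℂ) * X + C (M 1 1 : ℂ)) ^ (d - j)

/-- `P^Γ(x) = ∑_{γ ∈ Γ(x)} (P|γ)(x)` for `P` of degree ≤ 2k. -/
def PGam (k : ℕ) (P : Polynomial ℂ) (x : ℝ) : ℂ :=
  ∑' γ : GammaSet x, Polynomial.eval (x : ℂ) (cslash (2 * k) γ.1 P)

/-- The real-valued homogenization of degree `d` of an integral polynomial. -/
def homR (d : ℕ) (P : Polynomial ℤ) (a b : ℝ) : ℝ :=
  ∑ j ∈ Finset.range (d + 1), (P.coeff j : ℝ) * a ^ j * b ^ (d - j)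

lemma homEval_cast (d : ℕ) (P : Polynomial ℤ) (r t : ℤ) :
    (homEval d P r t : ℝ) = homR d P r t := by
  simp [homEval, homR]

lemma aeval_pslash (d : ℕ) (M : Mat2) (P : Polynomial ℤ) (y : ℝ) :
    aeval y (pslash d M P) = homR d P (M 0 0 * y + M 0 1) (M 1 0 * y + M 1 1) := by
  simp [pslash, homR]

lemma natDegree_pslash_le (d : ℕ) (M : Mat2) (P : Polynomial ℤ) :
    (pslash d M P).natDegree ≤ d := by
  refine natDegree_sum_le_of_forall_le _ _ fun j hj => ?_
  have hj' : j ≤ d := Nat.lt_succ_iff.mp (Finset.mem_range.mp hj)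
  have hlin : ∀ (a b : ℤ) (n : ℕ), ((C a * X + C b) ^ n).natDegree ≤ n := fun a b n =>
    (natDegree_pow_le_of_le n natDegree_linear_le).trans (by simp)
  calc _ ≤ (0 + j) + (d - j) :=
        natDegree_mul_le_of_le
          (natDegree_mul_le_of_le (natDegree_C _).le (hlin _ _ _)) (hlin _ _ _)
    _ = d := by omega

lemma homR_apply_one {d : ℕ} {P : Polynomial ℤ} (hP : P.natDegree ≤ d) (y : ℝ) :
    homR d P y 1 = aeval y P := by
  rw [aeval_eq_sum_range' (Nat.lt_succ_of_le hP)]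
  simp [homR]

lemma homR_mul (d : ℕ) (P : Polynomial ℤ) (c a b : ℝ) :
    homR d P (c * a) (c * b) = c ^ d * homR d P a b := by
  unfold homR
  rw [Finset.mul_sum]
  refine Finset.sum_congr rfl fun j hj => ?_
  have hj' : j + (d - j) = d := by have := Finset.mem_range.mp hj; omega
  rw [mul_pow, mul_pow]
  nth_rewrite 3 [← hj']
  rw [pow_add]
  ring

lemma homR_apply_zero_right (d : ℕ) (P : Polynomial ℤ) (a : ℝ) :
    homR d P a 0 = a ^ d * P.coeff d := by
  unfold homR
  rw [Finset.sum_range_succ, Finset.sum_eq_zero]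
  · simp [mul_comm]
  · intro j hj
    have : d - j ≠ 0 := by have := Finset.mem_range.mp hj; omega
    simp [this]

lemma homR_eq_pow_mul_aeval {d : ℕ} {P : Polynomial ℤ} (hP : P.natDegree ≤ d) (a : ℝ) {b : ℝ}
    (hb : b ≠ 0) : homR d P a b = b ^ d * aeval (a / b) P := by
  rw [← homR_apply_one hP, ← homR_mul]
  congr 1 <;> field_simp

lemma homR_pslash (d : ℕ) (M : Mat2) (P : Polynomial ℤ) (a b : ℝ) :
    homR d (pslash d M P) a b = homR d P (M 0 0 * a + M 0 1 * b) (M 1 0 * a + M 1 1 * b) := by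
  have hcont : ∀ Q : Polynomial ℤ, Continuous fun z : ℝ × ℝ => homR d Q z.1 z.2 := fun Q => by
    unfold homR; fun_prop
  have h := Continuous.ext_on (dense_compl_singleton (0 : ℝ))
    (f := fun b => homR d (pslash d M P) a b)
    (g := fun b => homR d P (M 0 0 * a + M 0 1 * b) (M 1 0 * a + M 1 1 * b))
    ((hcont _).comp (f := fun b : ℝ => (a, b)) (by fun_prop))
    ((hcont _).comp (f := fun b : ℝ => ((M 0 0 * a + M 0 1 * b : ℝ), (M 1 0 * a + M 1 1 * b : ℝ)))
      (by fun_prop)) ?_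
  · exact congrFun h b
  · intro b hb
    have hb : b ≠ 0 := hb
    simp only
    rw [homR_eq_pow_mul_aeval (natDegree_pslash_le d M P) a hb, aeval_pslash, ← homR_mul]
    congr 1 <;> field_simp

lemma eq_of_forall_aeval_real {P Q : Polynomial ℤ} (h : ∀ y : ℝ, aeval y P = aeval y Q) :
    P = Q := by
  apply Polynomial.map_injective (Int.castRingHom ℝ) Int.cast_injective
  refine Polynomial.funext fun y => ?_
  have := h y
  simpa [aeval_def, eval₂_eq_eval_map] using this

lemma pslash_pslash (d : ℕ) (M N : Mat2) (P : Polynomial ℤ) :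
    pslash d M (pslash d N P) = pslash d (N * M) P := by
  refine eq_of_forall_aeval_real fun y => ?_
  rw [aeval_pslash, aeval_pslash, homR_pslash]
  congr 1 <;> simp [Matrix.mul_apply, Fin.sum_univ_two] <;> ring

lemma pslash_one {d : ℕ} {P : Polynomial ℤ} (hP : P.natDegree ≤ d) : pslash d 1 P = P := by
  refine eq_of_forall_aeval_real fun y => ?_
  rw [aeval_pslash, ← homR_apply_one hP]
  simp

lemma coeff_pslash_eq_homEval (d : ℕ) (M : Mat2) (P : Polynomial ℤ) :
    (pslash d M P).coeff d = homEval d P (M 0 0) (M 1 0) := by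
  have h := homR_pslash d M P 1 0
  rw [homR_apply_zero_right] at h
  have : ((pslash d M P).coeff d : ℝ) = homEval d P (M 0 0) (M 1 0) := by
    rw [homEval_cast]; simpa using h
  exact_mod_cast this

lemma homR_zero_one {d : ℕ} {P : Polynomial ℤ} (hP : P.natDegree ≤ d) :
    homR d P 0 1 = P.coeff 0 := by
  rw [homR_apply_one hP, ← Polynomial.coeff_zero_eq_aeval_zero']
  simp

/-- An integral affine form does not vanish at an irrational point. -/
lemma int_affine_ne_zero {x : ℝ} (hx : Irrational x) {c e : ℤ} (h : c ≠ 0 ∨ e ≠ 0) :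
    (c : ℝ) * x + e ≠ 0 := by
  intro h0
  by_cases hc : c = 0
  · subst hc
    simp at h0 h
    exact h h0
  · exact ((hx.intCast_mul hc).add_intCast e).ne_zero h0

lemma row_ne_zero {M : Mat2} (hM : IsUnit M.det) (i : Fin 2) : M i 0 ≠ 0 ∨ M i 1 ≠ 0 := by
  by_contra! h
  apply hM.ne_zero
  rw [Matrix.det_fin_two]
  fin_cases i <;> simp_all

lemma irrational_moeb {x : ℝ} (hx : Irrational x) {M : Mat2} (hM : IsUnit M.det) :
    Irrational (moeb M x) := by
  have hden := int_affine_ne_zero hx (row_ne_zero hM 1)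
  rintro ⟨q, hq⟩
  unfold moeb at hq
  rw [eq_div_iff hden] at hq
  have hd : ((M 0 0 * M 1 1 - M 0 1 * M 1 0 : ℤ) : ℝ) ≠ 0 := by
    rw [← Matrix.det_fin_two]; exact_mod_cast hM.ne_zero
  push_cast at hd
  by_cases h : (M 0 0 : ℝ) - q * M 1 0 = 0
  · apply hd
    linear_combination (M 1 1 : ℝ) * h + (M 1 0 : ℝ) * hq + x * M 1 0 * h
  · apply hx
    refine ⟨((q * M 1 1 - M 0 1) / (M 0 0 - q * M 1 0) : ℚ), ?_⟩
    push_cast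
    rw [div_eq_iff h]
    linear_combination hq

lemma homR_eq_zero_iff {d : ℕ} {P : Polynomial ℤ} (hP : P.natDegree ≤ d)
    (hc : P.coeff d ≠ 0) {w w' : ℝ} (h : HasTwoIrratRoots P w w') {a b : ℝ}
    (hab : a ≠ 0 ∨ b ≠ 0) : homR d P a b = 0 ↔ a = w * b ∨ a = w' * b := by
  by_cases hb : b = 0
  · subst hb
    have ha : a ≠ 0 := by simpa using hab
    simp [homR_apply_zero_right, ha, hc]
  · rw [homR_eq_pow_mul_aeval hP a hb, mul_eq_zero, h.2.2.2, div_eq_iff hb, div_eq_iff hb]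
    simp [hb]

lemma moeb_eq_iff {w : ℝ} (hw : Irrational w) {M : Mat2} (hM : IsUnit M.det) (y : ℝ) :
    (M 0 0 * y + M 0 1 : ℝ) = w * (M 1 0 * y + M 1 1) ↔
      y = moeb !![-M 1 1, M 0 1; M 1 0, -M 0 0] w := by
  have hden := int_affine_ne_zero hw (c := M 1 0) (e := -M 0 0) (by
    by_contra! h
    apply hM.ne_zero
    rw [Matrix.det_fin_two]
    simp_all)
  simp only [moeb, of_apply, cons_val', cons_val_zero, cons_val_fin_one, cons_val_one]
  rw [eq_div_iff hden]
  push_cast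
  constructor <;> intro h <;> linear_combination -h

lemma pslash_mem_Fd {d : ℕ} {P : Polynomial ℤ} (hP : P ∈ Fd d) (hc : P.coeff d ≠ 0) {M : Mat2}
    (hM : IsUnit M.det) : pslash d M P ∈ Fd d := by
  obtain ⟨hdeg, w, w', hroots⟩ := hP
  obtain ⟨hne, hw, hw', -⟩ := id hroots
  have hM' : IsUnit (Matrix.det !![-M 1 1, M 0 1; M 1 0, -M 0 0]) := by
    have : Matrix.det !![-M 1 1, M 0 1; M 1 0, -M 0 0] = M.det := by
      simp [Matrix.det_fin_two]; ring
    rwa [this]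
  refine ⟨natDegree_pslash_le d M P, moeb !![-M 1 1, M 0 1; M 1 0, -M 0 0] w,
    moeb !![-M 1 1, M 0 1; M 1 0, -M 0 0] w', ?_, irrational_moeb hw hM',
    irrational_moeb hw' hM', fun y => ?_⟩
  · intro h
    have h1 := (moeb_eq_iff hw hM _).2 rfl
    have h2 := (moeb_eq_iff hw' hM _).2 rfl
    rw [← h] at h2
    set y := moeb !![-M 1 1, M 0 1; M 1 0, -M 0 0] w
    have h3 : (M 1 0 * y + M 1 1 : ℝ) ≠ 0 :=
      int_affine_ne_zero (irrational_moeb hw hM') (row_ne_zero hM 1)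
    exact hne (mul_right_cancel₀ h3 (h1.symm.trans h2))
  · rw [aeval_pslash, homR_eq_zero_iff hdeg hc hroots, moeb_eq_iff hw hM, moeb_eq_iff hw' hM]
    by_contra! h
    have hd : ((M 0 0 * M 1 1 - M 0 1 * M 1 0 : ℤ) : ℝ) ≠ 0 := by
      rw [← Matrix.det_fin_two]; exact_mod_cast hM.ne_zero
    apply hd
    push_cast
    linear_combination (-M 1 0 : ℝ) * h.1 + (M 0 0 : ℝ) * h.2

lemma IsClassF.pslash_mem {d : ℕ} {A : Set (Polynomial ℤ)} (hA : IsClassF d A)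
    {P : Polynomial ℤ} (hP : P ∈ A) (hc : P.coeff d ≠ 0) {M : Mat2} (hM : IsUnit M.det) :
    pslash d M P ∈ A := by
  obtain ⟨P₀, -, rfl⟩ := hA
  obtain ⟨hF, N, hN, rfl⟩ := hP
  exact ⟨pslash_mem_Fd hF hc hM, N * M, by rw [Matrix.det_mul]; exact hN.mul hM,
    pslash_pslash d M N P₀⟩

lemma IsClassF.mem_Fd {d : ℕ} {A : Set (Polynomial ℤ)} (hA : IsClassF d A)
    {P : Polynomial ℤ} (hP : P ∈ A) : P ∈ Fd d := by
  obtain ⟨P₀, -, rfl⟩ := hA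
  exact hP.1

/-- A real function that is continuous on an interval with endpoints of opposite signs vanishes
strictly inside. -/
lemma exists_zero_of_mul_neg {f : ℝ → ℝ} (hf : Continuous f) {a b : ℝ} (hab : a ≤ b)
    (h : f a * f b < 0) : ∃ c, a < c ∧ c < b ∧ f c = 0 := by
  have hfa : f a ≠ 0 := by rintro h0; simp [h0] at h
  have hfb : f b ≠ 0 := by rintro h0; simp [h0] at h
  have key : ∃ c ∈ Set.Icc a b, f c = 0 := by
    rcases mul_neg_iff.1 h with ⟨h1, h2⟩ | ⟨h1, h2⟩
    · exact intermediate_value_Icc' hab hf.continuousOn ⟨h2.le, h1.le⟩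
    · exact intermediate_value_Icc hab hf.continuousOn ⟨h1.le, h2.le⟩
  obtain ⟨c, ⟨hac, hcb⟩, hc⟩ := key
  refine ⟨c, lt_of_le_of_ne hac ?_, lt_of_le_of_ne hcb ?_, hc⟩
  · rintro rfl; exact hfa hc
  · rintro rfl; exact hfb hc

/-- For even `d`, the sign of a polynomial of degree `d` near infinity is that of its leading
coefficient. -/
lemma exists_bound_coeff_mul_aeval_pos {d : ℕ} (hde : Even d) {P : Polynomial ℤ}
    (hP : P.natDegree ≤ d) (hc : P.coeff d ≠ 0) :
    ∃ B : ℝ, 0 < B ∧ ∀ y : ℝ, B < |y| → 0 < (P.coeff d : ℝ) * aeval y P := by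
  have hcont : Continuous fun b : ℝ => (P.coeff d : ℝ) * homR d P 1 b := by
    unfold homR; fun_prop
  have h0 : 0 < (P.coeff d : ℝ) * homR d P 1 0 := by
    rw [homR_apply_zero_right, one_pow, one_mul]
    exact mul_self_pos.2 (by exact_mod_cast hc)
  obtain ⟨ε, hε, h⟩ := Metric.eventually_nhds_iff.1 (hcont.continuousAt.eventually_const_lt h0)
  refine ⟨1 / ε, by positivity, fun y hy => ?_⟩
  have hy0 : 0 < |y| := lt_trans (by positivity) hy
  have hyne : y ≠ 0 := abs_pos.1 hy0
  have h1 : 0 < (P.coeff d : ℝ) * homR d P 1 y⁻¹ := by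
    apply h
    rw [Real.dist_0_eq_abs, abs_inv]
    rw [div_lt_iff₀ hε] at hy
    exact inv_lt_of_inv_lt₀ hε (by rw [inv_eq_one_div, div_lt_iff₀ hε]; exact hy)
  have h2 : aeval y P = y ^ d * homR d P 1 y⁻¹ := by
    rw [← homR_mul, mul_one, mul_inv_cancel₀ hyne, homR_apply_one hP]
  rw [h2, mul_left_comm]
  exact mul_pos (hde.pow_pos hyne) h1

/-- If `P ∈ F_d` takes at `v` a value of sign opposite to `P(∞)`, then `v` lies between the two
roots and the homogenization of `P` has everywhere the sign of `P(∞)(a - wb)(a - w'b)`. -/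
lemma exists_roots_sign {d : ℕ} (hde : Even d) {P : Polynomial ℤ} (hP : P ∈ Fd d) {v : ℝ}
    (hv : (P.coeff d : ℝ) * aeval v P < 0) :
    ∃ w w' : ℝ, HasTwoIrratRoots P w w' ∧ w < v ∧ v < w' ∧
      ∀ a b : ℝ, (0 < P.coeff d * homR d P a b ↔ 0 < (a - w * b) * (a - w' * b)) ∧
        (P.coeff d * homR d P a b < 0 ↔ (a - w * b) * (a - w' * b) < 0) := by
  obtain ⟨hdeg, u, u', hu⟩ := hP
  have hc : P.coeff d ≠ 0 := by rintro h; simp [h] at hv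
  have hcR : (P.coeff d : ℝ) ≠ 0 := by exact_mod_cast hc
  obtain ⟨B, hB, hbig⟩ := exists_bound_coeff_mul_aeval_pos hde hdeg hc
  set f : ℝ → ℝ := fun y => P.coeff d * aeval y P with hf
  have hcont : Continuous f := by
    have := Polynomial.continuous_aeval (A := ℝ) P
    fun_prop
  have hzero : ∀ y, f y = 0 ↔ y = u ∨ y = u' := fun y => by
    simp only [hf, mul_eq_zero, hcR, false_or]; exact hu.2.2.2 y
  have hleft : ∀ y, f y < 0 → ∃ r, r < y ∧ f r = 0 := fun y hy => by
    have hz : -(|y| + B + 1) < y := by have := neg_abs_le y; linarith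
    obtain ⟨r, -, h2, h3⟩ := exists_zero_of_mul_neg hcont hz.le
      (mul_neg_of_pos_of_neg (hbig _ (by
        rw [abs_neg, abs_of_pos (by positivity)]; have := abs_nonneg y; linarith)) hy)
    exact ⟨r, h2, h3⟩
  have hright : ∀ y, f y < 0 → ∃ r, y < r ∧ f r = 0 := fun y hy => by
    have hz : y < |y| + B + 1 := by have := le_abs_self y; linarith
    obtain ⟨r, h1, -, h3⟩ := exists_zero_of_mul_neg hcont hz.le
      (mul_neg_of_neg_of_pos hy (hbig _ (by
        rw [abs_of_pos (by positivity)]; have := abs_nonneg y; linarith)))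
    exact ⟨r, h1, h3⟩
  obtain ⟨w, hwv, hw0⟩ := hleft v hv
  obtain ⟨w', hvw', hw'0⟩ := hright v hv
  have hww' : w < w' := hwv.trans hvw'
  have hroots : HasTwoIrratRoots P w w' := by
    rcases (hzero w).1 hw0 with rfl | rfl <;> rcases (hzero w').1 hw'0 with rfl | rfl
    · exact absurd hww' (lt_irrefl _)
    · exact hu
    · exact ⟨hu.1.symm, hu.2.2.1, hu.2.1, fun y => (hu.2.2.2 y).trans or_comm⟩
    · exact absurd hww' (lt_irrefl _)
  have hzero' : ∀ y, f y = 0 → y = w ∨ y = w' := fun y hy => by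
    simp only [hf, mul_eq_zero, hcR, false_or] at hy
    exact (hroots.2.2.2 y).1 hy
  have hneg : ∀ y, w < y → y < w' → f y < 0 := fun y h1 h2 => by
    by_contra! h
    rcases h.eq_or_lt with h | h
    · rcases hzero' y h.symm with rfl | rfl <;> exact absurd ‹_› (lt_irrefl _)
    rcases le_total y v with h3 | h3
    · obtain ⟨r, h4, h5, h6⟩ :=
        exists_zero_of_mul_neg hcont h3 (mul_neg_of_pos_of_neg h hv)
      rcases hzero' r h6 with rfl | rfl <;> linarith
    · obtain ⟨r, h4, h5, h6⟩ :=
        exists_zero_of_mul_neg hcont h3 (mul_neg_of_neg_of_pos hv h)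
      rcases hzero' r h6 with rfl | rfl <;> linarith
  have hpos : ∀ y, y < w ∨ w' < y → 0 < f y := fun y hy => by
    by_contra! h
    rcases h.eq_or_lt with h | h
    · rcases hzero' y h with rfl | rfl <;> rcases hy with hy | hy <;> linarith
    rcases hy with hy | hy
    · obtain ⟨r, h4, h6⟩ := hleft y h
      rcases hzero' r h6 with rfl | rfl <;> linarith
    · obtain ⟨r, h4, h6⟩ := hright y h
      rcases hzero' r h6 with rfl | rfl <;> linarith
  have hfy : ∀ y, (0 < f y ↔ 0 < (y - w) * (y - w')) ∧ (f y < 0 ↔ (y - w) * (y - w') < 0) := by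
    intro y
    rcases lt_trichotomy y w with h | rfl | h
    · have h1 := hpos y (Or.inl h)
      have h2 : 0 < (y - w) * (y - w') := mul_pos_of_neg_of_neg (by linarith) (by linarith)
      simp only [h1, h2, h1.not_gt, h2.not_gt, and_self]
    · simp [hw0]
    rcases lt_trichotomy y w' with h' | rfl | h'
    · have h1 := hneg y h h'
      have h2 : (y - w) * (y - w') < 0 := mul_neg_of_pos_of_neg (by linarith) (by linarith)
      simp only [h1, h2, h1.not_gt, h2.not_gt, and_self]
    · simp [hw'0]
    · have h1 := hpos y (Or.inr h')
      have h2 : 0 < (y - w) * (y - w') := mul_pos (by linarith) (by linarith)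
      simp only [h1, h2, h1.not_gt, h2.not_gt, and_self]
  refine ⟨w, w', hroots, hwv, hvw', fun a b => ?_⟩
  by_cases hb : b = 0
  · subst hb
    rw [homR_apply_zero_right]
    have h1 : (P.coeff d : ℝ) * (a ^ d * P.coeff d) = (P.coeff d : ℝ) ^ 2 * a ^ d := by ring
    rw [h1]
    have hd : d ≠ 0 := by
      rintro rfl
      have h2 := hroots.2.2.2 w
      rw [Polynomial.eq_C_of_natDegree_le_zero hdeg] at h2
      simp [hc] at h2
    by_cases ha : a = 0
    · simp [ha, hd]
    · have h2 : 0 < (P.coeff d : ℝ) ^ 2 * a ^ d := mul_pos (by positivity) (hde.pow_pos ha)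
      have h3 : 0 < (a - w * 0) * (a - w' * 0) := by
        simp only [mul_zero, sub_zero]; exact mul_self_pos.2 ha
      simp only [h2, h3, h2.not_gt, h3.not_gt, and_self]
  · have h1 : (P.coeff d : ℝ) * homR d P a b = b ^ d * f (a / b) := by
      rw [homR_eq_pow_mul_aeval hdeg a hb, hf]; ring
    have h2 : (a - w * b) * (a - w' * b) = b ^ 2 * ((a / b - w) * (a / b - w')) := by
      field_simp
    have h3 : 0 < b ^ d := hde.pow_pos hb
    have h4 : 0 < b ^ 2 := by positivity
    rw [h1, h2, mul_pos_iff_of_pos_left h3, mul_pos_iff_of_pos_left h4]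
    refine ⟨(hfy _).1, ?_⟩
    rw [← not_le, ← not_le, mul_nonneg_iff_of_pos_left h3, mul_nonneg_iff_of_pos_left h4, not_le,
      not_le]
    exact (hfy _).2

/-- The point `γ'_i(x)`. -/
def gamPt (x : ℝ) (i : ℕ) : ℝ := moeb (gam' x i) x

/-- The inverse of `γ'_i`. -/
def gamInv (x : ℝ) (i : ℕ) : Mat2 := (gam' x i)⁻¹

lemma isUnit_det_gam' (x : ℝ) (i : ℕ) : IsUnit (gam' x i).det := by
  induction i with
  | zero => simp [gam']
  | succ i ih =>
    have h1 : IsUnit MT.det := by simp [MT, Matrix.det_fin_two]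
    have h2 : IsUnit (Tpow (-1)).det := by simp [Tpow, Matrix.det_fin_two]
    have h3 : IsUnit Meps.det := by simp [Meps, Matrix.det_fin_two]
    unfold gam'
    split_ifs <;> simp only [Matrix.det_mul]
    · exact h1.mul ih
    · exact (h2.mul h3).mul ih
    · exact h2.mul ih

lemma gamInv_mul (x : ℝ) (i : ℕ) : gamInv x i * gam' x i = 1 :=
  Matrix.nonsing_inv_mul _ (isUnit_det_gam' x i)

lemma mul_gamInv (x : ℝ) (i : ℕ) : gam' x i * gamInv x i = 1 :=
  Matrix.mul_nonsing_inv _ (isUnit_det_gam' x i)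

lemma isUnit_det_gamInv (x : ℝ) (i : ℕ) : IsUnit (gamInv x i).det :=
  Matrix.isUnit_nonsing_inv_det _ (isUnit_det_gam' x i)

lemma irrational_gamPt {x : ℝ} (hx : Irrational x) (i : ℕ) : Irrational (gamPt x i) :=
  irrational_moeb hx (isUnit_det_gam' x i)

lemma gamPt_zero (x : ℝ) : gamPt x 0 = x := by simp [gamPt, gam', moeb]

lemma gamInv_zero (x : ℝ) : gamInv x 0 = 1 := by simp [gamInv, gam']

/-- The relation between consecutive terms when the `i`-th one is nonpositive. -/
lemma step_of_neg {x : ℝ} (hx : Irrational x) {i : ℕ} (h : gamPt x i ≤ 0) :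
    gamPt x (i + 1) = gamPt x i + 1 ∧ gamInv x (i + 1) = gamInv x i * !![1, -1; 0, 1] := by
  have hden := int_affine_ne_zero hx (row_ne_zero (isUnit_det_gam' x i) 1)
  have hg : gam' x (i + 1) = MT * gam' x i := by
    have h0 : moeb (gam' x i) x ≤ 0 := h
    rw [gam', if_pos h0]
  constructor
  · rw [gamPt, hg, gamPt]
    simp only [moeb, MT, Matrix.mul_apply, Fin.sum_univ_two, of_apply, cons_val', cons_val_zero,
      cons_val_fin_one, cons_val_one]
    push_cast
    rw [div_add_one hden]
    congr 1 <;> ring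
  · rw [gamInv, hg, Matrix.mul_inv_rev, gamInv]
    congr 1
    simp [MT, Matrix.inv_def, Matrix.det_fin_two, Matrix.adjugate_fin_two]

/-- The relation between consecutive terms when the `i`-th one is in `(0, 1)`. -/
lemma step_of_lt_one {x : ℝ} (hx : Irrational x) {i : ℕ} (h0 : 0 < gamPt x i)
    (h : gamPt x i ≤ 1) :
    gamPt x (i + 1) = 1 / gamPt x i - 1 ∧ gamInv x (i + 1) = gamInv x i * !![0, 1; 1, 1] := by
  have hnum := int_affine_ne_zero hx (row_ne_zero (isUnit_det_gam' x i) 0)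
  have hg : gam' x (i + 1) = Tpow (-1) * Meps * gam' x i := by
    have h1 : moeb (gam' x i) x ≤ 1 := h
    have h2 : ¬ moeb (gam' x i) x ≤ 0 := not_le.2 h0
    rw [gam', if_neg h2, if_pos h1]
  constructor
  · rw [gamPt, hg, gamPt]
    simp only [moeb, Tpow, Meps, Matrix.mul_apply, Fin.sum_univ_two, of_apply, cons_val',
      cons_val_zero, cons_val_fin_one, cons_val_one]
    rw [one_div_div, div_sub_one hnum]
    push_cast
    congr 1 <;> ring
  · rw [gamInv, hg, Matrix.mul_inv_rev, gamInv]
    congr 1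
    apply Matrix.inv_eq_right_inv
    simp [Tpow, Meps, Matrix.one_fin_two]

/-- The relation between consecutive terms when the `i`-th one is greater than `1`. -/
lemma step_of_one_lt {x : ℝ} (hx : Irrational x) {i : ℕ} (h : 1 < gamPt x i) :
    gamPt x (i + 1) = gamPt x i - 1 ∧ gamInv x (i + 1) = gamInv x i * !![1, 1; 0, 1] := by
  have hden := int_affine_ne_zero hx (row_ne_zero (isUnit_det_gam' x i) 1)
  have hg : gam' x (i + 1) = Tpow (-1) * gam' x i := by
    have h1 : ¬ moeb (gam' x i) x ≤ 1 := not_le.2 h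
    have h0 : ¬ moeb (gam' x i) x ≤ 0 := not_le.2 (zero_lt_one.trans h)
    rw [gam', if_neg h0, if_neg h1]
  constructor
  · rw [gamPt, hg, gamPt]
    simp only [moeb, Tpow, Matrix.mul_apply, Fin.sum_univ_two, of_apply, cons_val', cons_val_zero,
      cons_val_fin_one, cons_val_one]
    push_cast
    rw [div_sub_one hden]
    congr 1 <;> ring
  · rw [gamInv, hg, Matrix.mul_inv_rev, gamInv]
    congr 1
    simp [Tpow, Matrix.inv_def, Matrix.det_fin_two, Matrix.adjugate_fin_two]

lemma gamPt_pos_succ {x : ℝ} (hx : Irrational x) {i : ℕ} (h : 0 < gamPt x i) :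
    0 < gamPt x (i + 1) := by
  have hne : gamPt x i ≠ 1 := by simpa using (irrational_gamPt hx i).ne_nat 1
  rcases hne.lt_or_gt with h1 | h1
  · rw [(step_of_lt_one hx h h1.le).1, sub_pos, lt_div_iff₀ h]; linarith
  · rw [(step_of_one_lt hx h1).1]; linarith

lemma gamPt_pos_of_le {x : ℝ} (hx : Irrational x) {i j : ℕ} (hij : i ≤ j) (h : 0 < gamPt x i) :
    0 < gamPt x j := by
  induction j, hij using Nat.le_induction with
  | base => exact h
  | succ j _ ih => exact gamPt_pos_succ hx ih

/-- Once `γ'_i(x) > 0`, a step replaces the columns `v₁, v₂` of `γ'_i⁻¹` by either `v₁` or `v₂`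
and `v₁ + v₂`. -/
lemma gamInv_succ_of_pos {x : ℝ} (hx : Irrational x) {i : ℕ} (h : 0 < gamPt x i) :
    (∀ k, gamInv x (i + 1) k 1 = gamInv x i k 0 + gamInv x i k 1) ∧
    ((∀ k, gamInv x (i + 1) k 0 = gamInv x i k 0) ∨
      (∀ k, gamInv x (i + 1) k 0 = gamInv x i k 1)) := by
  rcases le_or_gt (gamPt x i) 1 with h1 | h1
  · rw [(step_of_lt_one hx h h1).2]
    simp [Matrix.mul_apply, Fin.sum_univ_two]
  · rw [(step_of_one_lt hx h1).2]
    simp [Matrix.mul_apply, Fin.sum_univ_two]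

lemma gamInv_col_zero_of_nonpos {x : ℝ} (hx : Irrational x) (i : ℕ)
    (h : ∀ j < i, gamPt x j ≤ 0) :
    gamInv x i 0 0 = 1 ∧ gamInv x i 1 0 = 0 ∧ gamInv x i 1 1 = 1 := by
  induction i with
  | zero => simp [gamInv_zero]
  | succ i ih =>
    obtain ⟨h1, h2, h3⟩ := ih fun j hj => h j (hj.trans (Nat.lt_succ_self i))
    rw [(step_of_neg hx (h i (Nat.lt_succ_self i))).2]
    simp [Matrix.mul_apply, Fin.sum_univ_two, h1, h2, h3]

lemma gamInv_of_nonpos {x : ℝ} (hx : Irrational x) {i : ℕ} (h : gamPt x i ≤ 0) :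
    gamInv x i 0 0 = 1 ∧ gamInv x i 1 0 = 0 ∧ gamInv x i 1 1 = 1 :=
  gamInv_col_zero_of_nonpos hx i fun j hj => by
    by_contra! hpos
    exact absurd (gamPt_pos_of_le hx hj.le hpos) h.not_gt

lemma gamInv_nonneg {x : ℝ} (hx : Irrational x) (i : ℕ) :
    0 ≤ gamInv x i 1 0 ∧ 0 ≤ gamInv x i 1 1 := by
  induction i with
  | zero => simp [gamInv_zero]
  | succ i ih =>
    rcases le_or_gt (gamPt x i) 0 with h | h
    · obtain ⟨h1, h2, h3⟩ := gamInv_of_nonpos hx h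
      rw [(step_of_neg hx h).2]
      simp [Matrix.mul_apply, Fin.sum_univ_two, h2, h3]
    · obtain ⟨h1, h2⟩ := gamInv_succ_of_pos hx h
      rw [h1]
      rcases h2 with h2 | h2 <;> rw [h2] <;> constructor <;> linarith [ih.1, ih.2]

/-- The trajectory enters `(0, 1)` after finitely many unit translations. -/
lemma exists_gamPt_mem_Ioo {x : ℝ} (hx : Irrational x) :
    ∃ k, 0 < gamPt x k ∧ gamPt x k < 1 ∧ gamInv x k 1 1 = 1 := by
  have main : ∀ n : ℕ, ∀ i, |gamPt x i| ≤ n → gamInv x i 1 0 = 0 → gamInv x i 1 1 = 1 →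
      ∃ k, 0 < gamPt x k ∧ gamPt x k < 1 ∧ gamInv x k 1 1 = 1 := by
    intro n
    induction n with
    | zero =>
      intro i hi
      exfalso
      have : gamPt x i = 0 := by simpa using hi
      exact (irrational_gamPt hx i).ne_zero this
    | succ n ih =>
      intro i hi h0 h1
      push_cast at hi
      obtain ⟨hi1, hi2⟩ := abs_le.1 hi
      have hne0 : gamPt x i ≠ 0 := (irrational_gamPt hx i).ne_zero
      have hne : gamPt x i ≠ 1 := by simpa using (irrational_gamPt hx i).ne_nat 1
      rcases hne0.lt_or_gt with hs | hs
      · obtain ⟨ha, hb⟩ := step_of_neg hx hs.le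
        have hc : gamInv x (i + 1) 1 0 = 0 ∧ gamInv x (i + 1) 1 1 = 1 := by
          rw [hb]; simp [Matrix.mul_apply, Fin.sum_univ_two, h0, h1]
        by_cases hp : 0 < gamPt x (i + 1)
        · exact ⟨i + 1, hp, by rw [ha]; linarith, hc.2⟩
        · exact ih (i + 1) (abs_le.2 ⟨by rw [ha]; linarith, by
            have : (0 : ℝ) ≤ n := n.cast_nonneg
            linarith⟩) hc.1 hc.2
      rcases hne.lt_or_gt with hs1 | hs1
      · exact ⟨i, hs, hs1, h1⟩
      · obtain ⟨ha, hb⟩ := step_of_one_lt hx hs1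
        refine ih (i + 1) (abs_le.2 ⟨?_, ?_⟩) ?_ ?_
        · have : (0 : ℝ) ≤ n := n.cast_nonneg
          rw [ha]; linarith
        · rw [ha]; linarith
        · rw [hb]; simp [Matrix.mul_apply, Fin.sum_univ_two, h0]
        · rw [hb]; simp [Matrix.mul_apply, Fin.sum_univ_two, h0, h1]
  obtain ⟨n, hn⟩ := exists_nat_ge |x|
  exact main n 0 (by rwa [gamPt_zero]) (by simp [gamInv_zero]) (by simp [gamInv_zero])

lemma exists_gamInv_large {x : ℝ} (hx : Irrational x) :
    ∃ k, ∀ n : ℕ, 0 < gamPt x (k + n) ∧ 1 ≤ gamInv x (k + n) 1 0 ∧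
      (n : ℤ) + 1 ≤ gamInv x (k + n) 1 1 := by
  obtain ⟨k, h0, h1, h2⟩ := exists_gamPt_mem_Ioo hx
  have hnn := gamInv_nonneg hx k
  refine ⟨k + 1, fun n => ?_⟩
  induction n with
  | zero =>
    refine ⟨gamPt_pos_succ hx h0, ?_⟩
    rw [add_zero, (step_of_lt_one hx h0 h1.le).2]
    simp [Matrix.mul_apply, Fin.sum_univ_two, h2, hnn.1]
  | succ n ih =>
    obtain ⟨ha, hb, hc⟩ := ih
    obtain ⟨hd, he⟩ := gamInv_succ_of_pos hx ha
    rw [← add_assoc]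
    refine ⟨gamPt_pos_succ hx ha, ?_, ?_⟩
    · rcases he with he | he <;> rw [he] <;> omega
    · rw [hd]; push_cast; omega

/-- The columns of `γ'_i⁻¹` approximate `x`. -/
lemma gamInv_approx {x : ℝ} (hx : Irrational x) {i : ℕ} (h : 0 < gamPt x i)
    (h0 : 1 ≤ gamInv x i 1 0) (h1 : 1 ≤ gamInv x i 1 1) :
    |gamInv x i 0 0 - x * gamInv x i 1 0| * gamInv x i 1 1 ≤ 1 ∧
      |gamInv x i 0 1 - x * gamInv x i 1 1| ≤ 1 := by
  set N := gamInv x i with hN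
  have hmul := gamInv_mul x i
  rw [← hN] at hmul
  have hdet : |(N 0 0 * N 1 1 - N 0 1 * N 1 0 : ℝ)| = 1 := by
    have h2 := Int.isUnit_iff_abs_eq.1 (isUnit_det_gamInv x i)
    rw [← hN, Matrix.det_fin_two] at h2
    exact_mod_cast h2
  set G := gam' x i with hG
  have hden := int_affine_ne_zero hx (row_ne_zero (isUnit_det_gam' x i) 1)
  rw [← hG] at hden
  set L₂ : ℝ := G 1 0 * x + G 1 1 with hL₂
  set L₁ : ℝ := G 0 0 * x + G 0 1 with hL₁
  have hy : L₁ = gamPt x i * L₂ := by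
    rw [gamPt, moeb, ← hG, div_mul_cancel₀ _ hden]
  have e00 : (N 0 0 * G 0 0 + N 0 1 * G 1 0 : ℝ) = 1 := by
    have := congrFun (congrFun hmul 0) 0
    simp only [Matrix.mul_apply, Fin.sum_univ_two, Matrix.one_apply_eq] at this
    exact_mod_cast this
  have e01 : (N 0 0 * G 0 1 + N 0 1 * G 1 1 : ℝ) = 0 := by
    have := congrFun (congrFun hmul 0) 1
    simp [Matrix.mul_apply, Fin.sum_univ_two] at this
    exact_mod_cast this
  have e10 : (N 1 0 * G 0 0 + N 1 1 * G 1 0 : ℝ) = 0 := by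
    have := congrFun (congrFun hmul 1) 0
    simp [Matrix.mul_apply, Fin.sum_univ_two] at this
    exact_mod_cast this
  have e11 : (N 1 0 * G 0 1 + N 1 1 * G 1 1 : ℝ) = 1 := by
    have := congrFun (congrFun hmul 1) 1
    simp only [Matrix.mul_apply, Fin.sum_univ_two, Matrix.one_apply_eq] at this
    exact_mod_cast this
  have ex : x = N 0 0 * L₁ + N 0 1 * L₂ := by
    rw [hL₁, hL₂]; linear_combination (-x) * e00 - e01
  have e1 : (1 : ℝ) = N 1 0 * L₁ + N 1 1 * L₂ := by
    rw [hL₁, hL₂]; linear_combination (-x) * e10 - e11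
  have h0' : (1 : ℝ) ≤ N 1 0 := by exact_mod_cast h0
  have h1' : (1 : ℝ) ≤ N 1 1 := by exact_mod_cast h1
  have hL₂pos : 0 < L₂ := by
    rw [hy] at e1
    have : 0 < (N 1 0 * gamPt x i + N 1 1) * L₂ := by
      rw [show (N 1 0 * gamPt x i + N 1 1) * L₂ = 1 by rw [e1]; ring]
      exact one_pos
    exact (mul_pos_iff_of_pos_left (by positivity)).1 this
  have hL₁pos : 0 < L₁ := by rw [hy]; positivity
  have d1 : (N 0 0 - x * N 1 0 : ℝ) = (N 0 0 * N 1 1 - N 0 1 * N 1 0) * L₂ := by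
    linear_combination (N 0 0 : ℝ) * e1 - (N 1 0 : ℝ) * ex
  have d2 : (N 0 1 - x * N 1 1 : ℝ) = -(N 0 0 * N 1 1 - N 0 1 * N 1 0) * L₁ := by
    linear_combination (N 0 1 : ℝ) * e1 - (N 1 1 : ℝ) * ex
  rw [d1, d2, abs_mul, abs_mul, abs_neg, hdet, one_mul, one_mul, abs_of_pos hL₁pos,
    abs_of_pos hL₂pos]
  constructor
  · nlinarith
  · nlinarith

/-- The quadratic form that is positive exactly at the points strictly between `w` and `w'`. -/
def betweenForm (w w' a b : ℝ) : ℝ := (a - w * b) * (w' * b - a)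

/-- The value of `betweenForm` at the image of `(s, t)` under the inverse of `γ'_i`. -/
def pullForm (w w' x : ℝ) (i : ℕ) (s t : ℝ) : ℝ :=
  betweenForm w w' (gamInv x i 0 0 * s + gamInv x i 0 1 * t)
    (gamInv x i 1 0 * s + gamInv x i 1 1 * t)

/-- The pulled back form is positive at `∞` and `0` and negative at `-1`. -/
def PullReduced (w w' x : ℝ) (i : ℕ) : Prop :=
  0 < pullForm w w' x i 1 0 ∧ 0 < pullForm w w' x i 0 1 ∧ pullForm w w' x i (-1) 1 < 0

/-- The pulled back form is positive on `[0, ∞]`. -/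
def PullPos (w w' x : ℝ) (i : ℕ) : Prop :=
  ∀ s t : ℝ, 0 ≤ s → 0 ≤ t → 0 < s + t → 0 < pullForm w w' x i s t

lemma pullForm_expand (w w' x : ℝ) (i : ℕ) : ∃ β : ℝ, ∀ s t : ℝ,
    pullForm w w' x i s t =
      pullForm w w' x i 1 0 * s ^ 2 + β * (s * t) + pullForm w w' x i 0 1 * t ^ 2 := by
  refine ⟨pullForm w w' x i 1 1 - pullForm w w' x i 1 0 - pullForm w w' x i 0 1, fun s t => ?_⟩
  unfold pullForm betweenForm
  ring

/-- A quadratic form positive at `∞` and `0` and negative at a nonpositive point is positive on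
`[0, ∞]`. -/
lemma pullPos_of_neg {w w' x : ℝ} {i : ℕ} (h1 : 0 < pullForm w w' x i 1 0)
    (h2 : 0 < pullForm w w' x i 0 1) {a b : ℝ} (ha : 0 ≤ a) (hb : 0 ≤ b)
    (h : pullForm w w' x i a (-b) < 0) : PullPos w w' x i := by
  obtain ⟨β, hβ⟩ := pullForm_expand w w' x i
  have hβ0 : 0 < β := by
    by_contra! hle
    rw [hβ] at h
    have e1 : 0 ≤ pullForm w w' x i 1 0 * a ^ 2 := by positivity
    have e2 : 0 ≤ pullForm w w' x i 0 1 * (-b) ^ 2 := by positivity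
    have e3 : 0 ≤ (-β) * (a * b) := mul_nonneg (by linarith) (by positivity)
    linarith
  intro s t hs ht hst
  rw [hβ]
  have e : 0 ≤ β * (s * t) := by positivity
  rcases hs.eq_or_lt with rfl | hs
  · have : 0 < t := by linarith
    have : 0 < pullForm w w' x i 0 1 * t ^ 2 := by positivity
    simpa using this
  · have e1 : 0 < pullForm w w' x i 1 0 * s ^ 2 := by positivity
    have e2 : 0 ≤ pullForm w w' x i 0 1 * t ^ 2 := by positivity
    linarith

lemma PullReduced.pullPos {w w' x : ℝ} {i : ℕ} (h : PullReduced w w' x i) :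
    PullPos w w' x i := by
  refine pullPos_of_neg h.1 h.2.1 zero_le_one zero_le_one ?_
  have : pullForm w w' x i 1 (-1) = pullForm w w' x i (-1) 1 := by
    unfold pullForm betweenForm; ring
  rw [this]
  exact h.2.2

/-- The form after a step of the algorithm, in terms of the form before it. -/
lemma pullForm_succ {w w' x : ℝ} (hx : Irrational x) {i : ℕ} (h : 0 < gamPt x i) :
    (∀ s t, pullForm w w' x (i + 1) s t = pullForm w w' x i (s + t) t) ∨
      (∀ s t, pullForm w w' x (i + 1) s t = pullForm w w' x i t (s + t)) := by
  obtain ⟨h1, h2 | h2⟩ := gamInv_succ_of_pos hx h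
  · left
    intro s t
    simp only [pullForm, h1, h2]
    push_cast
    congr 1 <;> ring
  · right
    intro s t
    simp only [pullForm, h1, h2]
    push_cast
    congr 1 <;> ring

lemma PullPos.succ {w w' x : ℝ} (hx : Irrational x) {i : ℕ} (h : 0 < gamPt x i)
    (hp : PullPos w w' x i) : PullPos w w' x (i + 1) ∧ ¬ PullReduced w w' x (i + 1) := by
  rcases pullForm_succ (w := w) (w' := w') hx h with e | e
  · refine ⟨fun s t hs ht hst => ?_, fun hr => ?_⟩
    · rw [e]; exact hp _ _ (by positivity) ht (by positivity)
    · have h3 := hr.2.2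
      rw [e] at h3
      exact h3.not_gt (hp _ _ (by norm_num) (by norm_num) (by norm_num))
  · refine ⟨fun s t hs ht hst => ?_, fun hr => ?_⟩
    · rw [e]; exact hp _ _ ht (by positivity) (by positivity)
    · have h3 := hr.2.2
      rw [e] at h3
      exact h3.not_gt (hp _ _ (by norm_num) (by norm_num) (by norm_num))

lemma pullForm_one_zero_neg_of_nonpos {w w' x : ℝ} (hx : Irrational x) {i : ℕ}
    (h : gamPt x i ≤ 0) : pullForm w w' x i 1 0 < 0 := by
  obtain ⟨h1, h2, -⟩ := gamInv_of_nonpos hx h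
  simp [pullForm, betweenForm, h1, h2]

lemma PullReduced.gamPt_pos {w w' x : ℝ} (hx : Irrational x) {i : ℕ}
    (h : PullReduced w w' x i) : 0 < gamPt x i := by
  by_contra! hle
  exact (pullForm_one_zero_neg_of_nonpos hx hle).not_gt h.1

lemma PullReduced.not_lt {w w' x : ℝ} (hx : Irrational x) {i j : ℕ}
    (hi : PullReduced w w' x i) (hj : PullReduced w w' x j) : ¬ i < j := by
  intro hij
  have hpos : ∀ k, i ≤ k → PullPos w w' x k := fun k hk => by
    induction k, hk using Nat.le_induction with
    | base => exact hi.pullPos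
    | succ k hk ih => exact (ih.succ hx (gamPt_pos_of_le hx hk (hi.gamPt_pos hx))).1
  obtain ⟨k, rfl⟩ : ∃ k, j = k + 1 := ⟨j - 1, by omega⟩
  have hik : i ≤ k := by omega
  exact ((hpos k hik).succ hx (gamPt_pos_of_le hx hik (hi.gamPt_pos hx))).2 hj

lemma PullReduced.unique {w w' x : ℝ} (hx : Irrational x) {i j : ℕ}
    (hi : PullReduced w w' x i) (hj : PullReduced w w' x j) : i = j :=
  le_antisymm (Nat.le_of_not_lt (hj.not_lt hx hi)) (Nat.le_of_not_lt (hi.not_lt hx hj))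

lemma exists_pullPos {w w' x : ℝ} (hx : Irrational x) (hw : w < x) (hw' : x < w') :
    ∃ i, 0 < gamPt x i ∧ PullPos w w' x i := by
  obtain ⟨k, hk⟩ := exists_gamInv_large hx
  set η := min (x - w) (w' - x) with hη
  have hηpos : 0 < η := lt_min (by linarith) (by linarith)
  obtain ⟨n, hn⟩ := exists_nat_gt (1 / η)
  obtain ⟨hpos, h0, h1⟩ := hk n
  obtain ⟨ha, hb⟩ := gamInv_approx hx hpos h0 (by omega)
  refine ⟨k + n, hpos, fun s t hs ht hst => ?_⟩
  unfold pullForm betweenForm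
  set N := gamInv x (k + n)
  have h0' : (1 : ℝ) ≤ N 1 0 := by exact_mod_cast h0
  have h1' : (n : ℝ) + 1 ≤ N 1 1 := by exact_mod_cast h1
  have hη1 : 1 < η * N 1 1 := by
    rw [div_lt_iff₀ hηpos] at hn
    nlinarith
  have h1pos : (0 : ℝ) < N 1 1 := by
    have : (0 : ℝ) ≤ n := n.cast_nonneg
    linarith
  have ha' : |(N 0 0 - x * N 1 0 : ℝ)| < η * N 1 0 := by
    have : |(N 0 0 - x * N 1 0 : ℝ)| < η := by
      by_contra! hle
      nlinarith
    nlinarith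
  have hb' : |(N 0 1 - x * N 1 1 : ℝ)| < η * N 1 1 := hb.trans_lt hη1
  obtain ⟨ha1, ha2⟩ := abs_lt.1 ha'
  obtain ⟨hb1, hb2⟩ := abs_lt.1 hb'
  have hηw : η ≤ x - w := min_le_left _ _
  have hηw' : η ≤ w' - x := min_le_right _ _
  have A1 : (0 : ℝ) < N 0 0 - w * N 1 0 := by nlinarith
  have A2 : (0 : ℝ) < N 0 1 - w * N 1 1 := by nlinarith
  have B1 : (0 : ℝ) < w' * N 1 0 - N 0 0 := by nlinarith
  have B2 : (0 : ℝ) < w' * N 1 1 - N 0 1 := by nlinarith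
  have key : ∀ u v : ℝ, 0 < u → 0 < v → 0 < s * u + t * v := fun u v hu hv => by
    rcases hs.eq_or_lt with rfl | hs
    · have : 0 < t := by linarith
      rw [zero_mul, zero_add]; positivity
    · positivity
  refine mul_pos ?_ ?_
  · have := key _ _ A1 A2; linarith
  · have := key _ _ B1 B2; linarith

lemma betweenForm_ne_zero {w w' : ℝ} (hw : Irrational w) (hw' : Irrational w') {a b : ℤ}
    (h : a ≠ 0 ∨ b ≠ 0) : betweenForm w w' a b ≠ 0 := by
  refine mul_ne_zero ?_ ?_
  · have := int_affine_ne_zero hw (c := -b) (e := a) (by simpa using h.symm)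
    push_cast at this
    intro h0; apply this; linarith
  · have := int_affine_ne_zero hw' (c := b) (e := -a) (by simpa using h.symm)
    push_cast at this
    intro h0; apply this; linarith

lemma col_ne_zero {M : Mat2} (hM : IsUnit M.det) (i : Fin 2) : M 0 i ≠ 0 ∨ M 1 i ≠ 0 :=
  row_ne_zero (M := Mᵀ) (by rwa [Matrix.det_transpose]) i

lemma exists_pullReduced {w w' x : ℝ} (hx : Irrational x) (hwi : Irrational w)
    (hwi' : Irrational w') (hw : w < x) (hw' : x < w') :
    ∃ i, 1 ≤ i ∧ PullReduced w w' x i := by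
  classical
  have hex := exists_pullPos hx hw hw'
  obtain ⟨hpos, hP⟩ := Nat.find_spec hex
  set m := Nat.find hex with hm
  have hinit : ∀ i, (∀ j < i, gamPt x j ≤ 0) → ¬ PullPos w w' x i := fun i hi hp => by
    obtain ⟨h1, h2, -⟩ := gamInv_col_zero_of_nonpos hx i hi
    have := hp 1 0 zero_le_one le_rfl (by norm_num)
    simp only [pullForm, betweenForm, h1, h2] at this
    norm_num at this
  obtain ⟨i, hi⟩ : ∃ i, m = i + 1 := by
    refine ⟨m - 1, ?_⟩
    have : m ≠ 0 := fun h0 => hinit m (fun j hj => by omega) hP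
    omega
  rw [hi] at hP
  have hposi : 0 < gamPt x i := by
    by_contra! hle
    refine hinit (i + 1) (fun j hj => ?_) hP
    by_contra! hj'
    exact hle.not_gt (gamPt_pos_of_le hx (Nat.lt_succ_iff.1 hj) hj')
  have hnot : ¬ PullPos w w' x i := fun hp =>
    Nat.find_min hex (m := i) (by omega) ⟨hposi, hp⟩
  refine ⟨i + 1, by omega, hP 1 0 zero_le_one le_rfl (by norm_num),
    hP 0 1 le_rfl zero_le_one (by norm_num), ?_⟩
  by_contra! hge
  have hdet := isUnit_det_gamInv x i
  have hne1 : pullForm w w' x i 1 0 ≠ 0 := by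
    simpa [pullForm] using betweenForm_ne_zero hwi hwi' (col_ne_zero hdet 0)
  have hne2 : pullForm w w' x i 0 1 ≠ 0 := by
    simpa [pullForm] using betweenForm_ne_zero hwi hwi' (col_ne_zero hdet 1)
  have hcols : 0 < pullForm w w' x i 1 0 ∧ 0 < pullForm w w' x i 0 1 := by
    have hp := hP 1 0 zero_le_one le_rfl (by norm_num)
    rcases pullForm_succ (w := w) (w' := w') hx hposi with e | e
    · rw [e] at hp hge
      norm_num at hp hge
      exact ⟨hp, lt_of_le_of_ne hge hne2.symm⟩
    · rw [e] at hp hge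
      norm_num at hp hge
      exact ⟨lt_of_le_of_ne hge hne1.symm, hp⟩
  obtain ⟨hq1, hq2⟩ := gamInv_nonneg hx i
  refine hnot (pullPos_of_neg hcols.1 hcols.2 (a := gamInv x i 1 1) (b := gamInv x i 1 0)
    (by exact_mod_cast hq2) (by exact_mod_cast hq1) ?_)
  have hd : ((gamInv x i 0 0 * gamInv x i 1 1 - gamInv x i 0 1 * gamInv x i 1 0 : ℤ) : ℝ) ≠ 0 := by
    rw [← Matrix.det_fin_two]; exact_mod_cast hdet.ne_zero
  push_cast at hd
  have : 0 < (gamInv x i 0 0 * gamInv x i 1 1 - gamInv x i 0 1 * gamInv x i 1 0 : ℝ) ^ 2 := by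
    positivity
  unfold pullForm betweenForm
  linarith

/-- Reducedness of `P|γ'_i⁻¹`, for `P ∈ A⟨x⟩`, in terms of the roots of `P`. -/
lemma exists_pslash_gamInv_mem_PRed_iff {d : ℕ} (hde : Even d) {A : Set (Polynomial ℤ)}
    (hA : IsClassF d A) {x : ℝ} {P : Polynomial ℤ} (hP : P ∈ Px d A x) :
    ∃ w w' : ℝ, Irrational w ∧ Irrational w' ∧ w < x ∧ x < w' ∧
      ∀ i, pslash d (gamInv x i) P ∈ PRed d A ↔ PullReduced w w' x i := by
  obtain ⟨hPA, hc, hPx⟩ := hP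
  have hc' : (P.coeff d : ℝ) < 0 := by exact_mod_cast hc
  obtain ⟨w, w', hroots, hw, hw', hsign⟩ :=
    exists_roots_sign hde (hA.mem_Fd hPA) (mul_neg_of_neg_of_pos hc' hPx)
  refine ⟨w, w', hroots.2.1, hroots.2.2.1, hw, hw', fun i => ?_⟩
  have hform : ∀ a b, betweenForm w w' a b = -((a - w * b) * (a - w' * b)) := fun a b => by
    unfold betweenForm; ring
  have hpos : ∀ s t, 0 < homR d (pslash d (gamInv x i) P) s t ↔ 0 < pullForm w w' x i s t :=
    fun s t => by
      rw [homR_pslash, pullForm, hform, neg_pos, ← (hsign _ _).2, mul_neg_iff]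
      simp [hc', hc'.not_gt]
  have hneg : ∀ s t, homR d (pslash d (gamInv x i) P) s t < 0 ↔ pullForm w w' x i s t < 0 :=
    fun s t => by
      rw [homR_pslash, pullForm, hform, neg_lt_zero, ← (hsign _ _).1, mul_pos_iff]
      simp [hc', hc'.not_gt]
  have hdeg := natDegree_pslash_le d (gamInv x i) P
  have hmem : pslash d (gamInv x i) P ∈ A := hA.pslash_mem hPA hc.ne (isUnit_det_gamInv x i)
  have e1 := hpos 1 0
  have e2 := hpos 0 1
  have e3 := hneg (-1) 1
  rw [homR_apply_zero_right, one_pow, one_mul, Int.cast_pos] at e1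
  rw [homR_zero_one hdeg, Int.cast_pos] at e2
  have e4 : aeval (-1 : ℝ) (pslash d (gamInv x i) P) =
      ((aeval (-1 : ℤ) (pslash d (gamInv x i) P) : ℤ) : ℝ) := by
    simpa using aeval_algebraMap_apply ℝ (-1 : ℤ) (pslash d (gamInv x i) P)
  rw [homR_apply_one hdeg, e4, Int.cast_lt_zero] at e3
  simp only [PRed, Set.mem_ofPred_eq, PullReduced, hmem, true_and, e1, e2, e3]
  tauto

lemma pslash_gam'_mem_Px {d : ℕ} (hde : Even d) {A : Set (Polynomial ℤ)}
    (hA : IsClassF d A) {x : ℝ} (hx : Irrational x) {P : Polynomial ℤ} (hP : P ∈ PRed d A)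
    {i : ℕ} (h : homEval d P (gam' x i 0 0) (gam' x i 1 0) < 0) :
    pslash d (gam' x i) P ∈ Px d A x := by
  obtain ⟨hPA, hc, hneg, h0⟩ := hP
  have hc' : (0 : ℝ) < P.coeff d := by exact_mod_cast hc
  have hF := hA.mem_Fd hPA
  have hneg' : aeval (-1 : ℝ) P < 0 := by
    have : aeval (-1 : ℝ) P = ((aeval (-1 : ℤ) P : ℤ) : ℝ) := by
      simpa using aeval_algebraMap_apply ℝ (-1 : ℤ) P
    rw [this]; exact_mod_cast hneg
  obtain ⟨w, w', -, hw, hw', hsign⟩ :=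
    exists_roots_sign hde hF (mul_neg_of_pos_of_neg hc' hneg')
  have hw'0 : w' < 0 := by
    have h1 := (hsign 0 1).1
    rw [homR_zero_one hF.1] at h1
    have h2 := h1.1 (mul_pos hc' (by exact_mod_cast h0))
    nlinarith
  have hy : 0 < gamPt x i := by
    by_contra! hle
    obtain ⟨h1, h2, -⟩ := gamInv_of_nonpos hx hle
    have hmul := mul_gamInv x i
    have h3 := congrFun (congrFun hmul 0) 0
    have h4 := congrFun (congrFun hmul 1) 0
    simp [Matrix.mul_apply, Fin.sum_univ_two, h1, h2] at h3 h4
    have h5 : (homEval d P 1 0 : ℝ) = P.coeff d := by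
      rw [homEval_cast]; push_cast; rw [homR_apply_zero_right, one_pow, one_mul]
    have h6 : homEval d P 1 0 = P.coeff d := by exact_mod_cast h5
    rw [h3, h4, h6] at h
    exact h.not_gt hc
  refine ⟨hA.pslash_mem hPA hc.ne' (isUnit_det_gam' x i), ?_, ?_⟩
  · rw [coeff_pslash_eq_homEval]; exact h
  · have hden := int_affine_ne_zero hx (row_ne_zero (isUnit_det_gam' x i) 1)
    rw [aeval_pslash, homR_eq_pow_mul_aeval hF.1 _ hden]
    refine mul_pos (hde.pow_pos hden) ?_
    have h1 := (hsign (gamPt x i) 1).1.2 (by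
      rw [mul_one, mul_one]; exact mul_pos (by linarith) (by linarith))
    rw [homR_apply_one hF.1] at h1
    exact (mul_pos_iff_of_pos_left hc').1 h1

lemma pslash_gamInv_pslash_gam' {d : ℕ} {P : Polynomial ℤ} (hP : P.natDegree ≤ d) (x : ℝ)
    (i : ℕ) : pslash d (gamInv x i) (pslash d (gam' x i) P) = P := by
  rw [pslash_pslash, mul_gamInv, pslash_one hP]

lemma pslash_gam'_pslash_gamInv {d : ℕ} {P : Polynomial ℤ} (hP : P.natDegree ≤ d) (x : ℝ)
    (i : ℕ) : pslash d (gam' x i) (pslash d (gamInv x i) P) = P := by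
  rw [pslash_pslash, gamInv_mul, pslash_one hP]

/-- **Theorem 4 of the paper.** For even `d > 0`, `A` a `Γ`-equivalence
class in `F_d` and `x` irrational, the map `(P,γ) ↦ P|γ` is a bijection from
`{(P,γ) ∈ A^Red × Γ(x)' : P(γ(∞)) < 0}` onto `A⟨x⟩`. -/
theorem stmt4 (d : ℕ) (hd : 0 < d) (hde : Even d) (A : Set (Polynomial ℤ))
    (hA : IsClassF d A) (x : ℝ) (hx : Irrational x) :
    Set.BijOn (fun pg : Polynomial ℤ × Mat2 => pslash d pg.2 pg.1)
      {pg : Polynomial ℤ × Mat2 | pg.1 ∈ PRed d A ∧ pg.2 ∈ GammaSet' x ∧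
        homEval d pg.1 (pg.2 0 0) (pg.2 1 0) < 0}
      (Px d A x) := by
  refine ⟨?_, ?_, ?_⟩
  · rintro ⟨P, γ⟩ ⟨hP, ⟨i, -, hγ⟩, h⟩
    simp only at hγ h
    subst hγ
    exact pslash_gam'_mem_Px hde hA hx hP h
  · rintro ⟨P, γ⟩ ⟨hP, ⟨i, -, hγ⟩, h⟩ ⟨Q, γ'⟩ ⟨hQ, ⟨j, -, hγ'⟩, h'⟩ heq
    simp only at hP hQ hγ hγ' h h' heq
    subst hγ hγ'
    have hmem := pslash_gam'_mem_Px hde hA hx hP h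
    have hPi := pslash_gamInv_pslash_gam' (hA.mem_Fd hP.1).1 x i
    have hQj := pslash_gamInv_pslash_gam' (hA.mem_Fd hQ.1).1 x j
    rw [← heq] at hQj
    obtain ⟨w, w', -, -, -, -, hiff⟩ := exists_pslash_gamInv_mem_PRed_iff hde hA hmem
    have hi := (hiff i).1 (by rwa [hPi])
    have hj := (hiff j).1 (by rwa [hQj])
    obtain rfl := hi.unique hx hj
    rw [← hPi, hQj]
  · intro P hP
    obtain ⟨w, w', hwi, hwi', hw, hw', hiff⟩ := exists_pslash_gamInv_mem_PRed_iff hde hA hP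
    obtain ⟨i, hi, hred⟩ := exists_pullReduced hx hwi hwi' hw hw'
    have hback := pslash_gam'_pslash_gamInv (hA.mem_Fd hP.1).1 x i
    refine ⟨(pslash d (gamInv x i) P, gam' x i), ⟨(hiff i).2 hred, ⟨i, hi, rfl⟩, ?_⟩, hback⟩
    simp only
    rw [← coeff_pslash_eq_homEval, hback]
    exact hP.2.1
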